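/- Let n ≥ 2 be even, L ≥ 1, and fix i ∈ ZMod n. For each layer index ℓ ∈ {1,…,L}, define the brick pairing σ_ℓ : ZMod n → ZMod n by σ_ℓ(p) = p + 1 if p + ℓ is even and σ_ℓ(p) = p − 1 otherwise (so σ_ℓ is an involution pairing each qubit with its gate partner in layer ℓ, with alternating brick offsets). Consider the set of trajectories ((p₀, a₀), (p₁, a₁), …, (p_L, a_L)) with p_ℓ ∈ ZMod n and a_ℓ ∈ Fin 3, satisfying: (i) for each ℓ ∈ {1,…,L}, p_ℓ ∈ {p_{ℓ−1}, σ_ℓ(p_{ℓ−1})}; (ii) a₀ = 2 and a_L = 2 (the Pauli-Z label); (iii) p_L = i. Then the cardinality of this set is 2^L · 3^{L−1}. -/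

import Mathlib

/-- The brick pairing of layer `ℓ` on a ring of `n` qubits: qubit `p` is paired with `p + 1`
if `p + ℓ` is even and with `p − 1` otherwise. -/
def brickPartner (n : ℕ) (ℓ : ℕ) (p : ZMod n) : ZMod n :=
  if Even (p.val + ℓ) then p + 1 else p - 1

theorem even_val_add_one_iff {n : ℕ} [Fact (1 < n)] (hne : Even n) (p : ZMod n) (ℓ : ℕ) :
    Even ((p + 1).val + ℓ) ↔ ¬ Even (p.val + ℓ) := by
  have : NeZero n := ⟨(Nat.zero_lt_of_lt (Fact.out : 1 < n)).ne'⟩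
  have h : (p + 1).val % 2 = (p.val + 1) % 2 := by
    rw [ZMod.val_add, ZMod.val_one, Nat.mod_mod_of_dvd _ hne.two_dvd]
  rw [Nat.even_iff, Nat.even_iff]
  omega

theorem brickPartner_involutive {n : ℕ} [Fact (1 < n)] (hne : Even n) (ℓ : ℕ) :
    Function.Involutive (brickPartner n ℓ) := by
  intro p
  have h := even_val_add_one_iff hne p ℓ
  have h' := even_val_add_one_iff hne (p - 1) ℓ
  rw [sub_add_cancel] at h'
  by_cases hp : Even (p.val + ℓ)
  · simp [brickPartner, hp, h]
  · have hq : Even ((p - 1).val + ℓ) := not_not.1 (mt h'.2 hp)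
    simp [brickPartner, hp, hq]

theorem brickPartner_ne_self {n : ℕ} [Fact (1 < n)] (ℓ : ℕ) (p : ZMod n) :
    brickPartner n ℓ p ≠ p := by
  unfold brickPartner
  split_ifs <;> simp

/-- If every state has exactly `k ℓ` predecessors in step `ℓ`, then there are `∏ ℓ, k ℓ` chains
ending in a given state. -/
theorem card_chains_to {α : Type*} [Finite α] {m : ℕ} (r : Fin m → α → α → Prop)
    (k : Fin m → ℕ) (hk : ∀ ℓ y, Nat.card {x // r ℓ x y} = k ℓ) (z : α) :
    Nat.card {t : Fin (m + 1) → α //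
      (∀ ℓ, r ℓ (t ℓ.castSucc) (t ℓ.succ)) ∧ t (Fin.last m) = z} = ∏ ℓ, k ℓ := by
  induction m with
  | zero =>
    have : Unique {t : Fin 1 → α //
        (∀ ℓ : Fin 0, r ℓ (t ℓ.castSucc) (t ℓ.succ)) ∧ t (Fin.last 0) = z} :=
      { default := ⟨fun _ => z, fun ℓ => ℓ.elim0, rfl⟩
        uniq := fun t => Subtype.ext <| funext fun j => by
          rw [Subsingleton.elim j (Fin.last 0)]
          exact t.2.2 }
    rw [Nat.card_unique, Fin.prod_univ_zero]
  | succ m ih =>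
    let T := {q : Fin (m + 1) → α //
      (∀ ℓ : Fin m, r ℓ.succ (q ℓ.castSucc) (q ℓ.succ)) ∧ q (Fin.last m) = z}
    let e : {t : Fin (m + 2) → α //
        (∀ ℓ, r ℓ (t ℓ.castSucc) (t ℓ.succ)) ∧ t (Fin.last (m + 1)) = z} ≃
        Σ q : T, {x // r 0 x (q.1 0)} :=
      { toFun := fun t => ⟨⟨Fin.tail t.1, fun ℓ => t.2.1 ℓ.succ, t.2.2⟩, t.1 0, t.2.1 0⟩
        invFun := fun s => ⟨Fin.cons s.2.1 s.1.1, Fin.cases s.2.2 s.1.2.1, s.1.2.2⟩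
        left_inv := fun t => Subtype.ext (Fin.cons_self_tail t.1)
        right_inv := fun _ => rfl }
    have := Fintype.ofFinite T
    rw [Nat.card_congr e, Nat.card_sigma, Fin.prod_univ_succ,
      ← ih (fun ℓ => r ℓ.succ) (fun ℓ => k ℓ.succ) fun ℓ => hk ℓ.succ]
    simp_rw [hk]
    rw [Finset.sum_const, smul_eq_mul, mul_comm, Finset.card_univ, ← Nat.card_eq_fintype_card]

theorem card_stay_or_move {α : Type*} {f : α → α} (hf : Function.Involutive f)
    (hne : ∀ x, f x ≠ x) (y : α) : Nat.card {x // y = x ∨ y = f x} = 2 := by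
  have h : {x | y = x ∨ y = f x} = {y, f y} := by
    ext x
    simp only [Set.mem_ofPred_eq, Set.mem_insert_iff, Set.mem_singleton_iff, eq_comm (a := y),
      hf.eq_iff]
  change Nat.card ({x | y = x ∨ y = f x} : Set α) = 2
  rw [h, Nat.card_coe_set_eq, Set.ncard_pair (hne y).symm]

/-- Counting weight-`(L+1)` Pauli trajectories (Eq. (A26) of the paper): the number of
trajectories `((p₀,a₀),…,(p_L,a_L))` with `pₗ ∈ ZMod n`, `aₗ ∈ Fin 3`, such that at each layer
the position either stays or moves to its brick partner, the initial and final Pauli labels are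
`Z` (label `2`), and the final position is `i`, equals `2^L·3^(L−1)`. -/
theorem trajectory_count (n L : ℕ) [NeZero n] (hn : 2 ≤ n) (hne : Even n) (hL : 1 ≤ L)
    (i : ZMod n) :
    Nat.card {t : Fin (L + 1) → ZMod n × Fin 3 //
        (∀ ℓ : Fin L, (t ℓ.succ).1 = (t ℓ.castSucc).1 ∨
          (t ℓ.succ).1 = brickPartner n (ℓ.val + 1) (t ℓ.castSucc).1) ∧
        (t 0).2 = 2 ∧ (t (Fin.last L)).2 = 2 ∧ (t (Fin.last L)).1 = i} =
      2 ^ L * 3 ^ (L - 1) := by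
  have : Fact (1 < n) := ⟨hn⟩
  obtain ⟨m, rfl⟩ : ∃ m, L = m + 1 := ⟨L - 1, by omega⟩
  let r : Fin (m + 1) → ZMod n × Fin 3 → ZMod n × Fin 3 → Prop := fun ℓ x y =>
    (y.1 = x.1 ∨ y.1 = brickPartner n (ℓ.val + 1) x.1) ∧ (ℓ = 0 → x.2 = 2)
  have hk : ∀ ℓ y, Nat.card {x // r ℓ x y} = if ℓ = 0 then 2 else 6 := by
    intro ℓ y
    rw [Nat.card_congr (Equiv.subtypeProdEquivProd
      (p := fun x => y.1 = x ∨ y.1 = brickPartner n (ℓ.val + 1) x)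
      (q := fun a : Fin 3 => ℓ = 0 → a = 2)), Nat.card_prod,
      card_stay_or_move (brickPartner_involutive hne _) (brickPartner_ne_self _)]
    split_ifs with h <;> simp [h]
  have hcount := card_chains_to r _ hk (i, 2)
  rw [Fin.prod_univ_succ] at hcount
  simp only [Fin.succ_ne_zero, if_true, if_false, Finset.prod_const, Finset.card_univ,
    Fintype.card_fin] at hcount
  rw [Nat.add_sub_cancel, pow_succ', mul_assoc, ← mul_pow, show 2 * 3 = 6 from rfl, ← hcount]
  refine Nat.card_congr (Equiv.subtypeEquivRight fun t => ?_)
  simp only [r, Prod.ext_iff, forall_and, forall_eq, Fin.castSucc_zero]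
  tauto
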